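/- Let 𝒜 be a convex cone in (0,+∞)ᵖ with associated norm ‖·‖_𝒜 and dual norm ‖β‖_{𝒜,∘} = sup_{a∈𝒜: |a|₁≤1} (∑_{j=1}^p a_j β_j²)^{1/2}. Let 𝕊_𝒜 be the set of all S ⊆ {1,…,p} admissible with respect to 𝒜. Let 𝕏 ∈ ℝ^{n×p}, f, ξ ∈ ℝⁿ, y = f + ξ, λ > 0, and let β̂ be any solution of min_{β∈ℝᵖ}( ‖y − 𝕏β‖² + 2λ‖β‖_𝒜 ). If ‖(1/n)𝕏ᵀξ‖_{𝒜,∘} ≤ λ/2, then ‖𝕏β̂ − f‖² ≤ min over S ∈ 𝕊_𝒜 of [ min_{β: supp(β)=S} ‖𝕏β − f‖² + 9λ²/(4 q_𝒜²(S,3)) ], with the convention a/0 = +∞ for a > 0. -/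

import Mathlib

open MeasureTheory
open scoped ENNReal

/-- The scaled Euclidean norm `‖u‖ = sqrt((1/n) ∑ u_i²)` on `ℝⁿ`. -/
noncomputable def scaledNorm {n : ℕ} (u : Fin n → ℝ) : ℝ :=
  Real.sqrt ((∑ i, u i ^ 2) / n)

/-- Restriction of a vector to a set of coordinates (zero off `S`). -/
def restr {p : ℕ} (S : Finset (Fin p)) (β : Fin p → ℝ) : Fin p → ℝ :=
  fun j => if j ∈ S then β j else 0

/-- The norm generated by a convex cone `𝒜 ⊂ (0,∞)ᵖ`:
`‖β‖_𝒜 = inf_{a ∈ 𝒜} (1/2) ∑_j (β_j²/a_j + a_j)`. -/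
noncomputable def coneNorm {p : ℕ} (A : Set (Fin p → ℝ)) (β : Fin p → ℝ) : ℝ :=
  sInf {r | ∃ a ∈ A, r = (1 / 2) * ∑ j, (β j ^ 2 / a j + a j)}

/-- The dual norm `‖β‖_{𝒜,∘} = sup_{a ∈ 𝒜, |a|₁ ≤ 1} (∑_j a_j β_j²)^{1/2}`. -/
noncomputable def coneDualNorm {p : ℕ} (A : Set (Fin p → ℝ)) (β : Fin p → ℝ) : ℝ :=
  sSup {r | ∃ a ∈ A, (∑ j, |a j|) ≤ 1 ∧ r = Real.sqrt (∑ j, a j * β j ^ 2)}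

/-- `S` is admissible with respect to `𝒜`. -/
def Admissible {p : ℕ} (A : Set (Fin p → ℝ)) (S : Finset (Fin p)) : Prop :=
  ∀ a ∈ A, ∀ ε > (0:ℝ), ∃ bc bs : Fin p → ℝ,
    (∀ j ∈ S, bc j = 0) ∧ (∀ j ∉ S, 0 < bc j ∧ bc j < ε) ∧
    (∀ j ∉ S, bs j = 0) ∧ (∀ j ∈ S, 0 < bs j ∧ bs j < ε) ∧
    (restr S a + bc) ∈ A ∧ (restr Sᶜ a + bs) ∈ A

/-- The squared RE-type constant
`q_𝒜²(S,c₀) = min { ‖XΔ‖²/‖Δ_S‖_𝒜² : Δ_S ≠ 0, ‖Δ_{Sᶜ}‖_𝒜 ≤ c₀ ‖Δ_S‖_𝒜 }`. -/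
noncomputable def qASq {n p : ℕ} (X : Matrix (Fin n) (Fin p) ℝ)
    (A : Set (Fin p → ℝ)) (S : Finset (Fin p)) (c₀ : ℝ) : ℝ :=
  sInf {r | ∃ Δ : Fin p → ℝ, restr S Δ ≠ 0 ∧
    coneNorm A (restr Sᶜ Δ) ≤ c₀ * coneNorm A (restr S Δ) ∧
    r = scaledNorm (X.mulVec Δ) ^ 2 / coneNorm A (restr S Δ) ^ 2}

section ConeNorm

variable {p : ℕ} {A : Set (Fin p → ℝ)}

theorem coneNorm_le (hApos : ∀ a ∈ A, ∀ j, 0 < a j) {a : Fin p → ℝ} (ha : a ∈ A)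
    (β : Fin p → ℝ) : coneNorm A β ≤ (1 / 2) * ∑ j, (β j ^ 2 / a j + a j) := by
  refine csInf_le ⟨0, ?_⟩ ⟨a, ha, rfl⟩
  rintro r ⟨b, hb, rfl⟩
  have : 0 ≤ ∑ j, (β j ^ 2 / b j + b j) := Finset.sum_nonneg fun j _ => by
    have := hApos b hb j
    positivity
  linarith

theorem le_coneNorm (hAne : A.Nonempty) {β : Fin p → ℝ} {r : ℝ}
    (h : ∀ a ∈ A, r ≤ (1 / 2) * ∑ j, (β j ^ 2 / a j + a j)) : r ≤ coneNorm A β := by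
  obtain ⟨a, ha⟩ := hAne
  refine le_csInf ⟨_, a, ha, rfl⟩ ?_
  rintro _ ⟨b, hb, rfl⟩
  exact h b hb

theorem coneNorm_nonneg (hApos : ∀ a ∈ A, ∀ j, 0 < a j) (hAne : A.Nonempty)
    (β : Fin p → ℝ) : 0 ≤ coneNorm A β := by
  refine le_coneNorm hAne fun a ha => ?_
  have : 0 ≤ ∑ j, (β j ^ 2 / a j + a j) := Finset.sum_nonneg fun j _ => by
    have := hApos a ha j
    positivity
  linarith

theorem add_mem_of_convex_cone (hAconv : Convex ℝ A)
    (hAcone : ∀ (c : ℝ), 0 < c → ∀ a ∈ A, c • a ∈ A) {a b : Fin p → ℝ}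
    (ha : a ∈ A) (hb : b ∈ A) : a + b ∈ A := by
  have h := hAcone 2 two_pos _
    (hAconv ha hb (by norm_num : (0 : ℝ) ≤ 1 / 2) (by norm_num : (0 : ℝ) ≤ 1 / 2) (by norm_num))
  convert h using 1
  ext j
  simp only [Pi.add_apply, Pi.smul_apply, smul_eq_mul]
  ring

theorem coneNorm_add_le (hApos : ∀ a ∈ A, ∀ j, 0 < a j) (hAne : A.Nonempty)
    (hAconv : Convex ℝ A) (hAcone : ∀ (c : ℝ), 0 < c → ∀ a ∈ A, c • a ∈ A)
    (β γ : Fin p → ℝ) : coneNorm A (β + γ) ≤ coneNorm A β + coneNorm A γ := by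
  rw [← sub_le_iff_le_add]
  refine le_coneNorm hAne fun a ha => ?_
  rw [sub_le_comm]
  refine le_coneNorm hAne fun b hb => ?_
  rw [sub_le_iff_le_add, ← mul_add, ← Finset.sum_add_distrib]
  refine (coneNorm_le hApos (add_mem_of_convex_cone hAconv hAcone ha hb) _).trans ?_
  refine mul_le_mul_of_nonneg_left (Finset.sum_le_sum fun j _ => ?_) (by norm_num)
  have h1 := hApos a ha j
  have h2 := hApos b hb j
  have : (β j + γ j) ^ 2 / (a j + b j) ≤ β j ^ 2 / a j + γ j ^ 2 / b j := by
    rw [div_add_div _ _ h1.ne' h2.ne', div_le_div_iff₀ (by positivity) (by positivity)]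
    nlinarith [sq_nonneg (β j * b j - γ j * a j)]
  simp only [Pi.add_apply]
  linarith

theorem coneNorm_smul_le (hApos : ∀ a ∈ A, ∀ j, 0 < a j) (hAne : A.Nonempty)
    (hAcone : ∀ (c : ℝ), 0 < c → ∀ a ∈ A, c • a ∈ A) {c : ℝ} (hc : 0 < c)
    (β : Fin p → ℝ) : coneNorm A (c • β) ≤ c * coneNorm A β := by
  rw [← div_le_iff₀' hc]
  refine le_coneNorm hAne fun a ha => ?_
  rw [div_le_iff₀' hc]
  refine (coneNorm_le hApos (hAcone c hc a ha) _).trans_eq ?_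
  simp only [Finset.mul_sum]
  refine Finset.sum_congr rfl fun j _ => ?_
  have h1 := (hApos a ha j).ne'
  simp only [Pi.smul_apply, smul_eq_mul]
  field_simp

theorem coneNorm_congr_sq {β γ : Fin p → ℝ} (h : ∀ j, β j ^ 2 = γ j ^ 2) :
    coneNorm A β = coneNorm A γ := by
  simp only [coneNorm, h]

theorem sum_mul_le_coneNorm_mul_coneDualNorm (hApos : ∀ a ∈ A, ∀ j, 0 < a j)
    (hAne : A.Nonempty) (hAcone : ∀ (c : ℝ), 0 < c → ∀ a ∈ A, c • a ∈ A)
    (β γ : Fin p → ℝ) : ∑ j, β j * γ j ≤ coneNorm A β * coneDualNorm A γ := by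
  have hD0 : 0 ≤ coneDualNorm A γ := by
    refine Real.sSup_nonneg ?_
    rintro _ ⟨a, -, -, rfl⟩
    exact Real.sqrt_nonneg _
  have hbdd : BddAbove {r | ∃ a ∈ A, (∑ j, |a j|) ≤ 1 ∧ r = Real.sqrt (∑ j, a j * γ j ^ 2)} := by
    refine ⟨Real.sqrt (∑ j, γ j ^ 2), ?_⟩
    rintro _ ⟨a, -, ha1, rfl⟩
    gcongr with j
    have : |a j| ≤ 1 :=
      (Finset.single_le_sum (f := fun j => |a j|) (fun i _ => abs_nonneg _)
        (Finset.mem_univ j)).trans ha1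
    nlinarith [le_abs_self (a j), sq_nonneg (γ j)]
  have key : ∀ a ∈ A, ∑ j, β j * γ j ≤
      (1 / 2) * (∑ j, (β j ^ 2 / a j + a j)) * coneDualNorm A γ := by
    intro a ha
    rcases isEmpty_or_nonempty (Fin p) with hp | hp
    · simp
    have hs : 0 < ∑ j, a j := Finset.sum_pos (fun j _ => hApos a ha j) Finset.univ_nonempty
    set s := ∑ j, a j with hsdef
    set D := coneDualNorm A γ
    have hDa : ∑ j, a j * γ j ^ 2 ≤ s * D ^ 2 := by
      have h : Real.sqrt (∑ j, (s⁻¹ • a) j * γ j ^ 2) ≤ D := by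
        refine le_csSup hbdd ⟨s⁻¹ • a, hAcone _ (by positivity) a ha, ?_, rfl⟩
        simp only [Pi.smul_apply, smul_eq_mul, abs_mul, ← Finset.mul_sum]
        simp only [fun j => abs_of_pos (hApos a ha j), ← hsdef, abs_of_pos (inv_pos.2 hs)]
        exact (inv_mul_cancel₀ hs.ne').le
      rw [Real.sqrt_le_left hD0] at h
      simp only [Pi.smul_apply, smul_eq_mul, mul_assoc, ← Finset.mul_sum] at h
      rwa [inv_mul_le_iff₀ hs] at h
    have hcs : (∑ j, β j * γ j) ^ 2 ≤ (∑ j, β j ^ 2 / a j) * ∑ j, a j * γ j ^ 2 := by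
      refine Finset.sum_sq_le_sum_mul_sum_of_sq_le_mul _ (fun j _ => ?_) (fun j _ => ?_)
        (fun j _ => ?_)
      all_goals have h1 := hApos a ha j
      · positivity
      · positivity
      · exact le_of_eq (by field_simp)
    have hB : 0 ≤ ∑ j, β j ^ 2 / a j := Finset.sum_nonneg fun j _ => by
      have h1 := hApos a ha j
      positivity
    rw [Finset.sum_add_distrib, ← hsdef]
    refine abs_le_of_sq_le_sq' ?_ (by positivity) |>.2
    calc _ ≤ _ := hcs
      _ ≤ (∑ j, β j ^ 2 / a j) * (s * D ^ 2) := by gcongr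
      _ ≤ _ := by nlinarith [mul_nonneg (sq_nonneg (∑ j, β j ^ 2 / a j - s)) (sq_nonneg D)]
  rcases hD0.eq_or_lt with h0 | h0
  · obtain ⟨a, ha⟩ := hAne
    have := key a ha
    rw [← h0] at this ⊢
    simpa using this
  · rw [← div_le_iff₀ h0]
    refine le_coneNorm hAne fun a ha => ?_
    rw [div_le_iff₀ h0]
    exact key a ha

theorem restr_add_restr_compl (S : Finset (Fin p)) (β : Fin p → ℝ) :
    restr S β + restr Sᶜ β = β := by
  ext j
  by_cases h : j ∈ S <;> simp [restr, h]

theorem coneNorm_restr_le (hApos : ∀ a ∈ A, ∀ j, 0 < a j) {S : Finset (Fin p)}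
    {a b : Fin p → ℝ} {ε : ℝ} (hε : 0 < ε) (hb : ∀ j ∈ S, b j = 0) (hbε : ∀ j ∉ S, b j < ε)
    (hab : restr S a + b ∈ A) (β : Fin p → ℝ) :
    coneNorm A (restr S β) ≤ (1 / 2) * ∑ j ∈ S, (β j ^ 2 / a j + a j) + p * ε := by
  refine (coneNorm_le hApos hab _).trans ?_
  rw [← Finset.sum_add_sum_compl S, mul_add]
  have h1 : ∑ j ∈ S, (restr S β j ^ 2 / (restr S a + b) j + (restr S a + b) j) =
      ∑ j ∈ S, (β j ^ 2 / a j + a j) :=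
    Finset.sum_congr rfl fun j hj => by simp [restr, hj, hb j hj]
  have h2 : ∑ j ∈ Sᶜ, (restr S β j ^ 2 / (restr S a + b) j + (restr S a + b) j) ≤ p * ε :=
    calc _ ≤ ∑ j ∈ Sᶜ, ε := Finset.sum_le_sum fun j hj => by
          rw [Finset.mem_compl] at hj
          simpa [restr, hj] using (hbε j hj).le
      _ ≤ ∑ j : Fin p, ε :=
          Finset.sum_le_sum_of_subset_of_nonneg (Finset.subset_univ _) fun _ _ _ => hε.le
      _ = p * ε := by simp
  have h3 : 0 ≤ p * ε := by positivity
  rw [h1]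
  linarith

theorem Admissible.coneNorm_restr_add_le (hApos : ∀ a ∈ A, ∀ j, 0 < a j) (hAne : A.Nonempty)
    {S : Finset (Fin p)} (hS : Admissible A S) (β : Fin p → ℝ) :
    coneNorm A (restr S β) + coneNorm A (restr Sᶜ β) ≤ coneNorm A β := by
  refine le_coneNorm hAne fun a ha => le_of_forall_pos_le_add fun δ hδ => ?_
  have hε : 0 < δ / (2 * (p + 1)) := by positivity
  obtain ⟨bc, bs, h1, h2, h3, h4, h5, h6⟩ := hS a ha _ hε
  have h7 := coneNorm_restr_le hApos hε h1 (fun j hj => (h2 j hj).2) h5 β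
  have h8 := coneNorm_restr_le hApos hε (fun j hj => h3 j (Finset.mem_compl.1 hj))
    (fun j hj => (h4 j (by simpa using hj)).2) h6 β
  have h9 : p * (δ / (2 * (p + 1))) ≤ δ / 2 := by
    rw [← mul_div_assoc, div_le_div_iff₀ (by positivity) (by positivity)]
    nlinarith
  rw [← Finset.sum_add_sum_compl S]
  linarith

end ConeNorm

theorem scaledNorm_sq {n : ℕ} (u : Fin n → ℝ) : scaledNorm u ^ 2 = (∑ i, u i ^ 2) / n :=
  Real.sq_sqrt (by positivity)

theorem scaledNorm_sub_smul_sq {n : ℕ} (u v : Fin n → ℝ) (t : ℝ) :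
    scaledNorm (u - t • v) ^ 2 =
      scaledNorm u ^ 2 - 2 * t * ((∑ i, u i * v i) / n) + t ^ 2 * scaledNorm v ^ 2 := by
  simp only [scaledNorm_sq, mul_div_assoc', Finset.mul_sum, ← add_div, ← sub_div,
    ← Finset.sum_add_distrib, ← Finset.sum_sub_distrib]
  congr 1
  refine Finset.sum_congr rfl fun i _ => ?_
  simp only [Pi.sub_apply, Pi.smul_apply, smul_eq_mul]
  ring

theorem nonneg_of_forall_small_quadratic {x c : ℝ}
    (h : ∀ t : ℝ, 0 < t → t < 1 → 0 ≤ t * x + t ^ 2 * c) : 0 ≤ x := by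
  by_contra! hx
  have hd : 0 < |c| + |x| + 1 := by positivity
  have ht : 0 < |x| / (2 * (|c| + |x| + 1)) := by
    have := abs_pos.2 hx.ne
    positivity
  set t := |x| / (2 * (|c| + |x| + 1)) with htdef
  have ht2 : t * (2 * (|c| + |x| + 1)) = |x| := div_mul_cancel₀ _ (by positivity)
  have ht1 : t < 1 := by
    rw [htdef, div_lt_one (by positivity)]
    nlinarith [abs_nonneg c, abs_nonneg x]
  have h1 := h t ht ht1
  have h2 : 0 ≤ x + t * c := by
    refine nonneg_of_mul_nonneg_right ?_ ht
    linarith [h1, (by ring : t * (x + t * c) = t * x + t ^ 2 * c)]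
  rw [abs_of_neg hx] at ht2
  nlinarith [le_abs_self c, mul_le_mul_of_nonneg_left (le_abs_self c) ht.le, abs_nonneg x,
    mul_nonneg ht.le (abs_nonneg x), mul_nonneg ht.le (abs_nonneg c)]

/-- First-order optimality condition for the penalized least-squares estimator. -/
theorem inner_residual_le_of_minimizer {n p : ℕ} {A : Set (Fin p → ℝ)}
    (hApos : ∀ a ∈ A, ∀ j, 0 < a j) (hAne : A.Nonempty)
    (hAconv : Convex ℝ A) (hAcone : ∀ (c : ℝ), 0 < c → ∀ a ∈ A, c • a ∈ A)
    {X : Matrix (Fin n) (Fin p) ℝ} {y : Fin n → ℝ} {lam : ℝ} (hlam : 0 < lam)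
    {βhat : Fin p → ℝ}
    (hmin : ∀ b : Fin p → ℝ,
      scaledNorm (y - X.mulVec βhat) ^ 2 + 2 * lam * coneNorm A βhat
        ≤ scaledNorm (y - X.mulVec b) ^ 2 + 2 * lam * coneNorm A b) (β : Fin p → ℝ) :
    (∑ i, (y - X.mulVec βhat) i * X.mulVec (β - βhat) i) / n ≤
      lam * (coneNorm A β - coneNorm A βhat) := by
  suffices h : 0 ≤ 2 * (lam * (coneNorm A β - coneNorm A βhat) -
      (∑ i, (y - X.mulVec βhat) i * X.mulVec (β - βhat) i) / n) by linarith
  refine nonneg_of_forall_small_quadratic (c := scaledNorm (X.mulVec (β - βhat)) ^ 2) ?_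
  intro t ht ht1
  have h1 := hmin ((1 - t) • βhat + t • β)
  have h2 : y - X.mulVec ((1 - t) • βhat + t • β) =
      (y - X.mulVec βhat) - t • X.mulVec (β - βhat) := by
    rw [Matrix.mulVec_add, Matrix.mulVec_smul, Matrix.mulVec_smul, Matrix.mulVec_sub]
    module
  rw [h2, scaledNorm_sub_smul_sq] at h1
  have h3 : coneNorm A ((1 - t) • βhat + t • β) ≤ (1 - t) * coneNorm A βhat + t * coneNorm A β :=
    (coneNorm_add_le hApos hAne hAconv hAcone _ _).trans
      (add_le_add (coneNorm_smul_le hApos hAne hAcone (by linarith) _)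
        (coneNorm_smul_le hApos hAne hAcone ht _))
  nlinarith [mul_le_mul_of_nonneg_left h3 hlam.le]

theorem qASq_mul_sq_le {n p : ℕ} {X : Matrix (Fin n) (Fin p) ℝ} {A : Set (Fin p → ℝ)}
    {S : Finset (Fin p)} {c₀ : ℝ} {Δ : Fin p → ℝ} (hΔ : restr S Δ ≠ 0)
    (h : coneNorm A (restr Sᶜ Δ) ≤ c₀ * coneNorm A (restr S Δ)) :
    qASq X A S c₀ * coneNorm A (restr S Δ) ^ 2 ≤ scaledNorm (X.mulVec Δ) ^ 2 := by
  have hq : qASq X A S c₀ ≤ scaledNorm (X.mulVec Δ) ^ 2 / coneNorm A (restr S Δ) ^ 2 := by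
    refine csInf_le ⟨0, ?_⟩ ⟨Δ, hΔ, h, rfl⟩
    rintro _ ⟨Δ', -, -, rfl⟩
    positivity
  rcases (sq_nonneg (coneNorm A (restr S Δ))).eq_or_lt with h0 | h0
  · rw [← h0, mul_zero]
    positivity
  · exact (le_div_iff₀ h0).1 hq

/-- Sharp oracle inequality for the cone-penalized estimator on the event
`‖(1/n)Xᵀξ‖_{𝒜,∘} ≤ λ/2`.  The oracle bound over admissible sets `S`
(with the convention `a/0 = +∞`) is expressed in `ℝ≥0∞`. -/
theorem stmt14 (n p : ℕ) (hn : 0 < n)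
    (A : Set (Fin p → ℝ)) (hAne : A.Nonempty)
    (hApos : ∀ a ∈ A, ∀ j, 0 < a j)
    (hAconv : Convex ℝ A)
    (hAcone : ∀ (c : ℝ), 0 < c → ∀ a ∈ A, c • a ∈ A)
    (X : Matrix (Fin n) (Fin p) ℝ) (f ξ y : Fin n → ℝ) (hy : y = f + ξ)
    (lam : ℝ) (hlam : 0 < lam)
    (βhat : Fin p → ℝ)
    (hmin : ∀ b : Fin p → ℝ,
      scaledNorm (y - X.mulVec βhat) ^ 2 + 2 * lam * coneNorm A βhat
        ≤ scaledNorm (y - X.mulVec b) ^ 2 + 2 * lam * coneNorm A b)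
    (hevent : coneDualNorm A (fun j => (1 / n) * X.transpose.mulVec ξ j) ≤ lam / 2) :
    ENNReal.ofReal (scaledNorm (X.mulVec βhat - f) ^ 2)
      ≤ ⨅ (S : Finset (Fin p)) (_ : Admissible A S) (β : Fin p → ℝ)
          (_ : Function.support β = ↑S),
          (ENNReal.ofReal (scaledNorm (X.mulVec β - f) ^ 2) +
            ENNReal.ofReal (9 * lam ^ 2) / ENNReal.ofReal (4 * qASq X A S 3)) := by
  refine le_iInf₂ fun S hS => le_iInf₂ fun β hβ => ?_
  rcases le_or_gt (qASq X A S 3) 0 with hq | hq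
  · rw [ENNReal.ofReal_of_nonpos (by linarith : 4 * qASq X A S 3 ≤ 0),
      ENNReal.div_zero (ENNReal.ofReal_pos.2 (by positivity)).ne', add_top]
    exact le_top
  rw [← ENNReal.ofReal_div_of_pos (by positivity),
    ← ENNReal.ofReal_add (by positivity) (by positivity)]
  refine ENNReal.ofReal_le_ofReal ?_
  have hβS : restr S β = β := by
    ext j
    by_cases hj : j ∈ S
    · simp [restr, hj]
    · have : j ∉ Function.support β := by simpa [hβ] using hj
      simp [restr, hj, Function.notMem_support.1 this]
  set N := coneNorm A with hN
  set Δ := βhat - β with hΔ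
  have hadd : ∀ u v, N (u + v) ≤ N u + N v := coneNorm_add_le hApos hAne hAconv hAcone
  have hopt := inner_residual_le_of_minimizer hApos hAne hAconv hAcone hlam hmin β
  have hpol : scaledNorm (X.mulVec β - f) ^ 2 = scaledNorm (X.mulVec βhat - f) ^ 2 -
      2 * ((∑ i, (X.mulVec βhat - f) i * X.mulVec Δ i) / n) + scaledNorm (X.mulVec Δ) ^ 2 := by
    have := scaledNorm_sub_smul_sq (X.mulVec βhat - f) (X.mulVec Δ) 1
    rw [mul_one, one_pow, one_mul, one_smul] at this
    rw [← this, hΔ, Matrix.mulVec_sub]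
    congr 2
    abel
  have hsplit : (∑ i, (y - X.mulVec βhat) i * X.mulVec (β - βhat) i) / n =
      (∑ i, (X.mulVec βhat - f) i * X.mulVec Δ i) / n -
        ∑ j, Δ j * ((1 / n) * X.transpose.mulVec ξ j) := by
    have h1 : ∑ j, Δ j * ((1 / n) * X.transpose.mulVec ξ j) =
        (∑ i, ξ i * X.mulVec Δ i) / n := by
      have h2 : ∑ i, ξ i * X.mulVec Δ i = ∑ j, Δ j * X.transpose.mulVec ξ j := by
        change ξ ⬝ᵥ X.mulVec Δ = Δ ⬝ᵥ X.transpose.mulVec ξ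
        rw [Matrix.dotProduct_mulVec, Matrix.mulVec_transpose, dotProduct_comm]
      rw [h2, Finset.sum_div]
      exact Finset.sum_congr rfl fun j _ => by ring
    rw [h1, ← sub_div, ← Finset.sum_sub_distrib]
    congr 1
    refine Finset.sum_congr rfl fun i _ => ?_
    rw [← neg_sub βhat β, ← hΔ, Matrix.mulVec_neg, hy]
    simp only [Pi.sub_apply, Pi.add_apply, Pi.neg_apply]
    ring
  have hholder : ∑ j, Δ j * ((1 / n) * X.transpose.mulVec ξ j) ≤ N Δ * (lam / 2) :=
    (sum_mul_le_coneNorm_mul_coneDualNorm hApos hAne hAcone Δ _).trans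
      (mul_le_mul_of_nonneg_left hevent (coneNorm_nonneg hApos hAne Δ))
  have hΔle : N Δ ≤ N (restr S Δ) + N (restr Sᶜ Δ) := by
    simpa only [restr_add_restr_compl] using hadd (restr S Δ) (restr Sᶜ Δ)
  have hdec := hS.coneNorm_restr_add_le hApos hAne βhat
  have htri : N β ≤ N (restr S Δ) + N (restr S βhat) := by
    have h1 := hadd (-restr S Δ) (restr S βhat)
    have h2 : -restr S Δ + restr S βhat = β := by
      rw [← hβS]
      ext j
      by_cases hj : j ∈ S <;> simp [restr, hj, hΔ]
    have h3 : N (-restr S Δ) = N (restr S Δ) := coneNorm_congr_sq fun j => by simp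
    rwa [h2, h3] at h1
  have hcompl : restr Sᶜ Δ = restr Sᶜ βhat := by
    rw [hΔ, ← hβS]
    ext j
    by_cases hj : j ∈ S <;> simp [restr, hj]
  rw [← hcompl, ← hN] at hdec
  rw [hsplit] at hopt
  have hmain : scaledNorm (X.mulVec βhat - f) ^ 2 + scaledNorm (X.mulVec Δ) ^ 2 ≤
      scaledNorm (X.mulVec β - f) ^ 2 + lam * (3 * N (restr S Δ) - N (restr Sᶜ Δ)) := by
    nlinarith [mul_le_mul_of_nonneg_left hΔle hlam.le,
      mul_le_mul_of_nonneg_left (add_le_add htri hdec) hlam.le]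
  have hNc : 0 ≤ N (restr Sᶜ Δ) := coneNorm_nonneg hApos hAne _
  have hX0 : 0 ≤ scaledNorm (X.mulVec Δ) ^ 2 := sq_nonneg _
  rcases le_or_gt (N (restr Sᶜ Δ)) (3 * N (restr S Δ)) with hcone | hcone
  · have hq2 : qASq X A S 3 * N (restr S Δ) ^ 2 ≤ scaledNorm (X.mulVec Δ) ^ 2 := by
      by_cases h0 : restr S Δ = 0
      · have hz : N (restr S Δ) = 0 := by
          have h1 := coneNorm_smul_le hApos hAne hAcone (c := 1 / 2) (by norm_num) (restr S Δ)
          have h2 := coneNorm_nonneg hApos hAne (restr S Δ)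
          rw [h0, smul_zero] at h1
          rw [h0] at h2 ⊢
          linarith
        rw [hz]
        simp [hX0]
      · exact qASq_mul_sq_le h0 hcone
    have hyoung : 3 * lam * N (restr S Δ) ≤
        qASq X A S 3 * N (restr S Δ) ^ 2 + 9 * lam ^ 2 / (4 * qASq X A S 3) := by
      rw [← sub_le_iff_le_add', le_div_iff₀ (by positivity)]
      nlinarith [sq_nonneg (2 * qASq X A S 3 * N (restr S Δ) - 3 * lam)]
    nlinarith [mul_nonneg hlam.le hNc]
  · have : 0 ≤ 9 * lam ^ 2 / (4 * qASq X A S 3) := by positivity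
    nlinarith [mul_pos hlam (sub_pos.2 hcone)]
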